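/- For every budget B > 0, there is no deterministic mechanism M = (x,p) on n = 2 agents satisfying IR and BF such that both (a) x_1(c) = x_2(c) = 1 for every c ∈ [0,B]^2 with c_1 + c_2 ≤ B, and (b) for each i ∈ {1,2} and each c_i ∈ [0,B) there exists c_{−i} ∈ [0,B] with x_i(c_i,c_{−i}) = 1 and p_i(c_i,c_{−i}) = B. -/

import Mathlib

open Finset

/-- The set of declared cost profiles lying in the box `[0,B]^n`. -/
def InBox {n : ℕ} (B : ℝ) (c : Fin n → ℝ) : Prop := ∀ i, c i ∈ Set.Icc (0:ℝ) B

/-- For every budget `B > 0`, there is no IR and BF mechanism on two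
agents such that (a) both agents are selected whenever `c 0 + c 1 ≤ B`, and (b) every
agent reporting a cost in `[0,B)` has an opposing report on which they are selected
and paid the whole budget `B`. -/
theorem no_IR_BF_with_full_selection_and_full_budget_tickets (B : ℝ) (hB : 0 < B) :
    ¬ ∃ x p : (Fin 2 → ℝ) → Fin 2 → ℝ,
      (∀ c, InBox B c → ∀ i, x c i = 0 ∨ x c i = 1) ∧
      (∀ c, InBox B c → ∀ i, 0 ≤ p c i) ∧
      (∀ c, InBox B c → ∀ i, c i * x c i ≤ p c i) ∧
      (∀ c, InBox B c → ∑ i, p c i ≤ B) ∧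
      (∀ c, InBox B c → c 0 + c 1 ≤ B → x c 0 = 1 ∧ x c 1 = 1) ∧
      (∀ i : Fin 2, ∀ ci ∈ Set.Ico (0:ℝ) B, ∃ c : Fin 2 → ℝ, c i = ci ∧
        (∀ j, j ≠ i → c j ∈ Set.Icc (0:ℝ) B) ∧ x c i = 1 ∧ p c i = B) := by
  rintro ⟨x, p, -, -, hIR, hBF, hsel, hticket⟩
  simp only [Fin.sum_univ_two] at hBF
  have h₀ : (0:ℝ) ∈ Set.Ico (0:ℝ) B := ⟨le_rfl, hB⟩
  have h₀' : (0:ℝ) ∈ Set.Icc (0:ℝ) B := ⟨le_rfl, hB.le⟩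
  have paid₀ : p 0 0 = B := by
    obtain ⟨c, hc0, hc, -, hp⟩ := hticket 0 0 h₀
    have hc1 := hc 1 (by decide)
    have hbox : InBox B c := Fin.forall_fin_two.2 ⟨hc0 ▸ h₀', hc1⟩
    have hx := (hsel c hbox (by linarith [hc1.2])).2
    have hIR1 := hIR c hbox 1
    rw [hx] at hIR1
    have hz : c = 0 := funext <| Fin.forall_fin_two.2
      ⟨hc0, le_antisymm (by simp only [Pi.zero_apply]; linarith [hBF c hbox]) hc1.1⟩
    rwa [hz] at hp
  have paid₁ : p 0 1 = B := by
    obtain ⟨c, hc1, hc, -, hp⟩ := hticket 1 0 h₀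
    have hc0 := hc 0 (by decide)
    have hbox : InBox B c := Fin.forall_fin_two.2 ⟨hc0, hc1 ▸ h₀'⟩
    have hx := (hsel c hbox (by linarith [hc0.2])).1
    have hIR0 := hIR c hbox 0
    rw [hx] at hIR0
    have hz : c = 0 := funext <| Fin.forall_fin_two.2
      ⟨le_antisymm (by simp only [Pi.zero_apply]; linarith [hBF c hbox]) hc0.1, hc1⟩
    rwa [hz] at hp
  linarith [hBF 0 fun _ => h₀']
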